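/- Let m > 2 be an integer and let p_1, …, p_{m-1} ∈ (0,1) satisfy p_1 + ⋯ + p_{m-1} < 1; set p_m := 1 − (p_1 + ⋯ + p_{m-1}), and fix L > 0. For each N, let X^(N) be the length of a uniformly random stick after N stages of the fixed multi-proportion fragmentation, i.e. X^(N) = L·∏_{j=1}^{N} p_{w(j)} where w is chosen uniformly at random from the m^N functions w : {1,…,N} → {1,…,m}. If y_i = log_{10}(p_i/p_{i+1}) is rational for every 1 ≤ i ≤ m−1, then the sequence {X^(N)} does not converge to strong Benford's law base 10. -/

import Mathlib

/-- The significand of a positive real `x` base 10: the unique `S ∈ [1,10)`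
with `x = S * 10^k` for some integer `k`. -/
noncomputable def signif (x : ℝ) : ℝ := (10 : ℝ) ^ Int.fract (Real.logb 10 x)

/-- The sequence of stick lengths after `N` stages of fixed multi-proportion
fragmentation with proportions `q : Fin m → ℝ` and initial length `L`
(the random stick is indexed by a uniformly random word `w : Fin N → Fin m`,
with length `L * ∏ j, q (w j)`) converges to strong Benford's law base 10:
for every `s ∈ [1,10]`, the probability that the significand is at most `s`
tends to `log₁₀ s`. -/
def StrongBenfordSticks (m : ℕ) (q : Fin m → ℝ) (L : ℝ) : Prop :=
  ∀ s ∈ Set.Icc (1 : ℝ) 10,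
    Filter.Tendsto
      (fun N : ℕ =>
        (Nat.card {w : Fin N → Fin m | signif (L * ∏ j, q (w j)) ≤ s} : ℝ) / (m : ℝ) ^ N)
      Filter.atTop (nhds (Real.logb 10 s))

/-- The full proportion vector `(p₁, …, p_{m-1}, 1 - (p₁ + ⋯ + p_{m-1}))`,
where `m = n + 1`. -/
noncomputable def fullProp {n : ℕ} (p : Fin n → ℝ) : Fin (n + 1) → ℝ :=
  Fin.snoc p (1 - ∑ i, p i)

theorem signif_le_rpow_iff (x t : ℝ) :
    signif x ≤ (10 : ℝ) ^ t ↔ Int.fract (Real.logb 10 x) ≤ t :=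
  Real.rpow_le_rpow_left_iff (by norm_num)

theorem fullProp_pos {n : ℕ} {p : Fin n → ℝ} (hp : ∀ i, 0 < p i) (hsum : ∑ i, p i < 1)
    (i : Fin (n + 1)) : 0 < fullProp p i := by
  induction i using Fin.lastCases with
  | last => simpa [fullProp] using hsum
  | cast i => simpa [fullProp] using hp i

/-- Finitely many rational numbers have a common denominator. -/
theorem exists_common_denominator {ι : Type*} [Fintype ι] (r : ι → ℚ) :
    ∃ D : ℕ, 0 < D ∧ ∀ i, ∃ k : ℤ, (D : ℝ) * (r i : ℝ) = k := by
  refine ⟨∏ i, (r i).den, Finset.prod_pos fun i _ => (r i).den_pos, fun i => ?_⟩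
  obtain ⟨c, hc⟩ := Finset.dvd_prod_of_mem (fun i => (r i).den) (Finset.mem_univ i)
  refine ⟨c * (r i).num, ?_⟩
  have h : ((r i).den : ℝ) * (r i : ℝ) = ((r i).num : ℝ) := by
    exact_mod_cast Rat.den_mul_eq_num (r i)
  rw [hc]
  push_cast
  linear_combination (c : ℝ) * h

/-- If consecutive ratios have rational logarithms, so do all ratios to the first entry. -/
theorem exists_rat_logb_sub {n : ℕ} {q : Fin (n + 1) → ℝ} (hq : ∀ i, 0 < q i)
    (hrat : ∀ i : Fin n, ∃ r : ℚ, Real.logb 10 (q i.castSucc / q i.succ) = (r : ℝ))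
    (i : Fin (n + 1)) : ∃ r : ℚ, Real.logb 10 (q i) - Real.logb 10 (q 0) = (r : ℝ) := by
  induction i using Fin.induction with
  | zero => exact ⟨0, by simp⟩
  | succ i ih =>
    obtain ⟨a, ha⟩ := ih
    obtain ⟨b, hb⟩ := hrat i
    rw [Real.logb_div (hq _).ne' (hq _).ne'] at hb
    exact ⟨a - b, by push_cast; linarith⟩

/-- Up to a constant depending only on `N`, the logarithms of all stick lengths after `N` stages
lie in `(1 / D) ℤ`. -/
theorem exists_int_logb_stick {m : ℕ} {q : Fin m → ℝ} (hq : ∀ i, 0 < q i) {L b : ℝ} (hL : 0 < L)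
    {D : ℕ} (hD : ∀ i, ∃ k : ℤ, (D : ℝ) * (Real.logb 10 (q i) - b) = k)
    {N : ℕ} (w : Fin N → Fin m) :
    ∃ k : ℤ, (D : ℝ) * Real.logb 10 (L * ∏ j, q (w j)) = D * (Real.logb 10 L + N * b) + k := by
  choose k hk using hD
  refine ⟨∑ j, k (w j), ?_⟩
  rw [Real.logb_mul hL.ne' (Finset.prod_pos fun j _ => hq _).ne',
    Real.logb_prod _ _ fun j _ => (hq _).ne']
  push_cast
  simp only [← hk, ← Finset.mul_sum, Finset.sum_sub_distrib, Finset.sum_const, Finset.card_univ,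
    Fintype.card_fin, nsmul_eq_mul]
  ring

/-- If the values of `f` differ by elements of `(1 / D) ℤ`, then two consecutive subintervals of
an interval of length less than `1 / D` cannot both contain values of `Int.fract ∘ f`. -/
theorem card_fract_le_eq_or {α : Type*} {f : α → ℝ} {D : ℕ} (hD : (0 : ℝ) < D) {c : ℝ}
    (hf : ∀ a, ∃ k : ℤ, (D : ℝ) * f a = c + k) {t₁ t₂ t₃ : ℝ} (h₁₂ : t₁ ≤ t₂) (h₂₃ : t₂ ≤ t₃)
    (h : D * (t₃ - t₁) < 1) :
    Nat.card {a | Int.fract (f a) ≤ t₂} = Nat.card {a | Int.fract (f a) ≤ t₁} ∨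
      Nat.card {a | Int.fract (f a) ≤ t₃} = Nat.card {a | Int.fract (f a) ≤ t₂} := by
  by_contra! hne
  have key : ∀ s t : ℝ, s ≤ t →
      Nat.card {a | Int.fract (f a) ≤ t} ≠ Nat.card {a | Int.fract (f a) ≤ s} →
      ∃ a, s < Int.fract (f a) ∧ Int.fract (f a) ≤ t := by
    intro s t hst hcard
    by_contra! hno
    refine hcard (congrArg (fun S : Set α => Nat.card S) ?_)
    ext a
    exact ⟨fun ha => le_of_not_gt fun hs => (hno a hs).not_ge ha, fun ha => le_trans ha hst⟩
  obtain ⟨a, ha₁, ha₂⟩ := key _ _ h₁₂ hne.1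
  obtain ⟨b, hb₂, hb₃⟩ := key _ _ h₂₃ hne.2
  obtain ⟨k, hk⟩ := hf a
  obtain ⟨l, hl⟩ := hf b
  have hz : (D : ℝ) * (Int.fract (f b) - Int.fract (f a)) =
      ((l - k - D * (⌊f b⌋ - ⌊f a⌋) : ℤ) : ℝ) := by
    push_cast
    simp only [Int.fract]
    linear_combination hl - hk
  have hpos : (0 : ℝ) < D * (Int.fract (f b) - Int.fract (f a)) :=
    mul_pos hD (by linarith)
  have hlt : (D : ℝ) * (Int.fract (f b) - Int.fract (f a)) < 1 :=
    lt_of_le_of_lt (mul_le_mul_of_nonneg_left (by linarith) hD.le) h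
  rw [hz] at hpos hlt
  have h0 : 0 < l - k - D * (⌊f b⌋ - ⌊f a⌋) := by exact_mod_cast hpos
  have h1 : l - k - D * (⌊f b⌋ - ⌊f a⌋) < 1 := by exact_mod_cast hlt
  omega

/-- Fixed multi-proportion stick fragmentation, non-Benford direction: with
`m = n + 1 > 2` proportions (the first `n` given, each in `(0,1)` with sum `< 1`,
the last defined as the complement) and initial length `L > 0`, if
`yᵢ = log₁₀ (pᵢ / pᵢ₊₁)` is rational for every `1 ≤ i ≤ m - 1`, then the lengths
of the sticks do not converge to strong Benford's law base 10. -/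
theorem multiProportion_not_strongBenford (n : ℕ) (hn : 2 ≤ n)
    (p : Fin n → ℝ) (hp : ∀ i, p i ∈ Set.Ioo (0 : ℝ) 1)
    (hsum : ∑ i, p i < 1) (L : ℝ) (hL : 0 < L)
    (hrat : ∀ i : Fin n,
      ∃ q : ℚ, Real.logb 10 (fullProp p i.castSucc / fullProp p i.succ) = (q : ℝ)) :
    ¬ StrongBenfordSticks (n + 1) (fullProp p) L := by
  intro hB
  have hq : ∀ i, 0 < fullProp p i := fullProp_pos (fun i => (hp i).1) hsum
  choose r hr using exists_rat_logb_sub hq hrat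
  obtain ⟨D, hD0, hD⟩ := exists_common_denominator r
  have hD0' : (0 : ℝ) < D := by exact_mod_cast hD0
  have hD1 : (1 : ℝ) ≤ D := by exact_mod_cast hD0
  simp only [← hr] at hD
  have hlim : ∀ t : ℝ, 0 ≤ t → t ≤ 1 → Filter.Tendsto
      (fun N : ℕ => (Nat.card {w : Fin N → Fin (n + 1) |
        Int.fract (Real.logb 10 (L * ∏ j, fullProp p (w j))) ≤ t} : ℝ) / ((n + 1 : ℕ) : ℝ) ^ N)
      Filter.atTop (nhds t) := by
    intro t ht0 ht1
    have h := hB ((10 : ℝ) ^ t) ⟨Real.one_le_rpow (by norm_num) ht0, by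
      simpa using Real.rpow_le_rpow_of_exponent_le (by norm_num : (1 : ℝ) ≤ 10) ht1⟩
    rw [Real.logb_rpow (by norm_num) (by norm_num)] at h
    simpa only [signif_le_rpow_iff] using h
  set ε : ℝ := 1 / (4 * D) with hε
  have hεD : D * ε = 1 / 4 := by rw [hε]; field_simp
  have hε0 : 0 < ε := by positivity
  have hε1 : ε ≤ 1 / 4 := by nlinarith
  have l₁ := hlim ε hε0.le (by linarith)
  have l₂ := hlim (2 * ε) (by linarith) (by linarith)
  have l₃ := hlim (3 * ε) (by linarith) (by linarith)
  have hprod := ((l₂.sub l₁).mul (l₃.sub l₂)).congr' (f₂ := fun _ => (0 : ℝ))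
    (Filter.Eventually.of_forall fun N => by
      rcases card_fract_le_eq_or hD0' (exists_int_logb_stick (N := N) hq hL hD)
        (t₁ := ε) (t₂ := 2 * ε) (t₃ := 3 * ε) (by linarith) (by linarith) (by linarith) with h | h
      · simp only [h, sub_self, zero_mul]
      · simp only [h, sub_self, mul_zero])
  have := tendsto_nhds_unique hprod tendsto_const_nhds
  nlinarith [mul_pos hε0 hε0]
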